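/- A connected graph G of order n ≥ 3 satisfies 𝔡(G) = n − 1 if and only if G is a path P_n or an odd cycle C_n. -/

import Mathlib

open SimpleGraph Finset

/-- Distance from a vertex to a finite set of vertices:
`min_{w ∈ S} d(u, w)`. -/
noncomputable def setDist {V : Type*} (G : SimpleGraph V) (u : V) (S : Finset V) : ℕ :=
  sInf (G.dist u '' (S : Set V))

/-- The set `𝒟_G(x,y)` of vertices distinguishing `x` and `y`. -/
noncomputable def DG {V : Type*} (G : SimpleGraph V) [Fintype V] (x y : V) : Finset V :=
  Finset.univ.filter fun z => G.dist z x ≠ G.dist z y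

/-- `𝔡(G) = min_{x ≠ y} |𝒟_G(x,y)|`. -/
noncomputable def frakd {V : Type*} (G : SimpleGraph V) [Fintype V] : ℕ :=
  sInf {m | ∃ x y : V, x ≠ y ∧ (DG G x y).card = m}

/-- `𝔡*(G) = max_{x ≠ y} |𝒟_G(x,y)|`. -/
noncomputable def frakdStar {V : Type*} (G : SimpleGraph V) [Fintype V] : ℕ :=
  sSup {m | ∃ x y : V, x ≠ y ∧ (DG G x y).card = m}

/-- A partition of the vertex set is a `k`-partition generator if every pair of
distinct vertices is distinguished by at least `k` parts. -/
noncomputable def IsKPartitionGenerator {V : Type*} (G : SimpleGraph V) [Fintype V]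
    [DecidableEq V] (k : ℕ) (P : Finpartition (Finset.univ : Finset V)) : Prop :=
  ∀ u v : V, u ≠ v → k ≤ (P.parts.filter fun S => setDist G u S ≠ setDist G v S).card

/-- The `k`-partition dimension `pd_k(G)`. -/
noncomputable def pd {V : Type*} (G : SimpleGraph V) [Fintype V] [DecidableEq V] (k : ℕ) : ℕ :=
  sInf {m | ∃ P : Finpartition (Finset.univ : Finset V),
    IsKPartitionGenerator G k P ∧ P.parts.card = m}

/-- A set of vertices is a `k`-metric generator if every pair of distinct
vertices is distinguished by at least `k` of its vertices. -/
def IsKMetricGenerator {V : Type*} (G : SimpleGraph V) [Fintype V] (k : ℕ) (W : Finset V) : Prop :=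
  ∀ u v : V, u ≠ v → k ≤ (W.filter fun z => G.dist z u ≠ G.dist z v).card

/-- The `k`-metric dimension `dim_k(G)`. -/
noncomputable def metricDim {V : Type*} (G : SimpleGraph V) [Fintype V] (k : ℕ) : ℕ :=
  sInf {m | ∃ W : Finset V, IsKMetricGenerator G k W ∧ W.card = m}

/-- At most one vertex is equidistant from any two distinct vertices. -/
def EqUniq {V : Type*} (G : SimpleGraph V) : Prop :=
  ∀ x y z w : V, x ≠ y → G.dist z x = G.dist z y → G.dist w x = G.dist w y → z = w

lemma card_DG_add {V : Type*} [Fintype V] (G : SimpleGraph V) (x y : V) :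
    (DG G x y).card + (Finset.univ.filter fun z => G.dist z x = G.dist z y).card
      = Fintype.card V := by
  classical
  unfold DG
  rw [add_comm]
  have := Finset.card_filter_add_card_filter_not (s := (Finset.univ : Finset V))
    (fun z => G.dist z x = G.dist z y)
  simpa using this

lemma eqUniq_of_frakd {V : Type*} [Fintype V] (G : SimpleGraph V)
    (hn : 3 ≤ Fintype.card V) (h : frakd G = Fintype.card V - 1) : EqUniq G := by
  classical
  intro x y z w hxy hz hw
  have h1 : frakd G ≤ (DG G x y).card := Nat.sInf_le ⟨x, y, hxy, rfl⟩
  have h2 := card_DG_add G x y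
  have h3 : (Finset.univ.filter fun z => G.dist z x = G.dist z y).card ≤ 1 := by omega
  exact Finset.card_le_one.1 h3 z (by simpa using hz) w (by simpa using hw)

lemma frakd_of_eqUniq {V : Type*} [Fintype V] (G : SimpleGraph V)
    (h : EqUniq G) (x y z : V) (hxy : x ≠ y) (hz : G.dist z x = G.dist z y) :
    frakd G = Fintype.card V - 1 := by
  classical
  apply le_antisymm
  · have h1 : frakd G ≤ (DG G x y).card := Nat.sInf_le ⟨x, y, hxy, rfl⟩
    have h2 := card_DG_add G x y
    have h3 : 0 < (Finset.univ.filter fun z => G.dist z x = G.dist z y).card :=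
      Finset.card_pos.2 ⟨z, by simpa using hz⟩
    omega
  · have hne : {m | ∃ x y : V, x ≠ y ∧ (DG G x y).card = m}.Nonempty := ⟨_, x, y, hxy, rfl⟩
    obtain ⟨a, b, hab, he⟩ := Nat.sInf_mem hne
    have h2 := card_DG_add G a b
    have h3 : (Finset.univ.filter fun z => G.dist z a = G.dist z b).card ≤ 1 := by
      refine Finset.card_le_one.2 fun p hp q hq => ?_
      exact h a b p q hab (by simpa using hp) (by simpa using hq)
    change (DG G a b).card = frakd G at he
    omega

lemma path_label {V R : Type*} [CommRing R] (G : SimpleGraph V) (h : V → R)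
    (hinj : Function.Injective h)
    (hadj : ∀ u v, G.Adj u v → h v = h u + 1 ∨ h v = h u - 1) :
    ∀ (u v : V) (p : G.Walk u v), p.IsPath →
      ∃ ε : R, (ε = 1 ∨ ε = -1) ∧ h v = h u + ε * p.length ∧
        (0 < p.length → h p.snd = h u + ε) := by
  intro u v p
  induction p with
  | nil => intro _; exact ⟨1, Or.inl rfl, by simp, by simp⟩
  | @cons u w v a p ih =>
    intro hp
    rw [SimpleGraph.Walk.cons_isPath_iff] at hp
    obtain ⟨ε, he, h1, h2⟩ := ih hp.1
    have hw : ∃ δ : R, (δ = 1 ∨ δ = -1) ∧ h w = h u + δ := by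
      rcases hadj u w a with h | h
      · exact ⟨1, Or.inl rfl, h⟩
      · exact ⟨-1, Or.inr rfl, by rw [h]; ring⟩
    obtain ⟨δ, hd, hw⟩ := hw
    refine ⟨δ, hd, ?_, fun _ => by simpa using hw⟩
    rcases Nat.eq_zero_or_pos p.length with h0 | h0
    · simp [h0] at h1
      simp [h0, h1, hw]
    · have h3 := h2 h0
      have : δ = ε := by
        by_contra hne
        have h4 : h p.snd = h u := by
          rw [h3, hw]
          rcases he with rfl | rfl <;> rcases hd with rfl | rfl <;> simp at hne ⊢
        exact hp.2 (hinj h4 ▸ p.getVert_mem_support 1)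
      subst this
      rw [h1, hw, SimpleGraph.Walk.length_cons]
      push_cast
      ring

lemma eqUniq_of_label {V R : Type*} [CommRing R] (G : SimpleGraph V) (hG : G.Connected)
    (h : V → R) (hinj : Function.Injective h)
    (h2 : ∀ a b : R, 2 * a = 2 * b → a = b)
    (hadj : ∀ u v, G.Adj u v → h v = h u + 1 ∨ h v = h u - 1) : EqUniq G := by
  have key : ∀ x y z : V, x ≠ y → G.dist z x = G.dist z y → 2 * h z = h x + h y := by
    intro x y z hxy hd
    obtain ⟨p, hp, hpl⟩ := hG.exists_path_of_dist z x
    obtain ⟨q, hq, hql⟩ := hG.exists_path_of_dist z y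
    obtain ⟨ε, he, hp1, -⟩ := path_label G h hinj hadj _ _ p hp
    obtain ⟨δ, hd', hq1, -⟩ := path_label G h hinj hadj _ _ q hq
    rw [hpl] at hp1
    rw [hql, ← hd] at hq1
    have hne : h x ≠ h y := fun e => hxy (hinj e)
    rw [hp1, hq1] at hne ⊢
    rcases he with rfl | rfl <;> rcases hd' with rfl | rfl
    · simp at hne
    · ring
    · ring
    · simp at hne
  intro x y z w hxy hz hw
  apply hinj
  apply h2
  rw [key x y z hxy hz, key x y w hxy hw]

lemma dist_invol {V : Type*} (G : SimpleGraph V) (hG : G.Connected) (s : V → V)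
    (hs : ∀ v, s (s v) = v) (hadj : ∀ u v, G.Adj u v → G.Adj (s u) (s v)) (u v : V) :
    G.dist (s u) (s v) = G.dist u v := by
  let f : G →g G := ⟨s, fun {a b} h => hadj a b h⟩
  have key : ∀ u v, G.dist (s u) (s v) ≤ G.dist u v := by
    intro u v
    obtain ⟨p, hp⟩ := hG.exists_walk_length_eq_dist u v
    rw [← hp, ← SimpleGraph.Walk.length_map f p]
    exact SimpleGraph.dist_le _
  apply le_antisymm (key u v)
  have := key (s u) (s v)
  rwa [hs, hs] at this

lemma deg_le_two {V : Type*} (G : SimpleGraph V) (hG : G.Connected) (h : EqUniq G)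
    (v a b c : V) (ha : G.Adj v a) (hb : G.Adj v b) (hc : G.Adj v c)
    (hab : a ≠ b) (hbc : b ≠ c) (hac : a ≠ c) : False := by
  have one : ∀ x, G.Adj v x → G.dist v x = 1 := fun x hx => SimpleGraph.dist_eq_one_iff_adj.2 hx
  have bd : ∀ x y, G.Adj v x → G.Adj v y → x ≠ y → 0 < G.dist x y ∧ G.dist x y ≤ 2 := by
    intro x y hx hy hxy
    refine ⟨hG.pos_dist_of_ne hxy, ?_⟩
    have := hG.dist_triangle (u := x) (v := v) (w := y)
    rw [SimpleGraph.dist_comm (u := x) (v := v), one x hx, one y hy] at this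
    exact this
  have ne : ∀ x y z, G.Adj v x → G.Adj v y → G.Adj v z → x ≠ y → G.dist z x ≠ G.dist z y := by
    intro x y z hx hy hz hxy he
    have := h x y v z hxy (by rw [one x hx, one y hy]) he
    subst this
    exact G.loopless.irrefl _ hz
  have h1 := bd a b ha hb hab
  have h2 := bd b c hb hc hbc
  have h3 := bd a c ha hc hac
  have e1 := ne a b c ha hb hc hab
  have e2 := ne b c a hb hc ha hbc
  have e3 := ne a c b ha hc hb hac
  rw [SimpleGraph.dist_comm (u := c) (v := a), SimpleGraph.dist_comm (u := c) (v := b)] at e1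
  rw [SimpleGraph.dist_comm (u := b) (v := a)] at e3
  omega

/-- `f` restricted to `{0,…,k-1}` is a path. -/
def IsPathFun {V : Type*} (G : SimpleGraph V) (k : ℕ) (f : ℕ → V) : Prop :=
  (∀ i, i + 1 < k → G.Adj (f i) (f (i + 1))) ∧ ∀ i j, i < k → j < k → f i = f j → i = j

lemma IsPathFun.le_card {V : Type*} [Fintype V] {G : SimpleGraph V} {k : ℕ} {f : ℕ → V}
    (h : IsPathFun G k f) : k ≤ Fintype.card V := by
  have : Function.Injective (fun i : Fin k => f i) := fun i j e => Fin.ext (h.2 i j i.2 j.2 e)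
  simpa using Fintype.card_le_of_injective _ this

lemma exists_max_path {V : Type*} [Fintype V] (G : SimpleGraph V) [Nonempty V] :
    ∃ k f, 1 ≤ k ∧ IsPathFun G k f ∧ ∀ g, ¬ IsPathFun G (k + 1) g := by
  classical
  let P : ℕ → Prop := fun k => ∃ f, IsPathFun G k f
  have h1 : P 1 := ⟨fun _ => Classical.arbitrary V, fun i hi => by omega, fun i j _ _ _ => by omega⟩
  have hc : 1 ≤ Fintype.card V := Fintype.card_pos
  obtain ⟨f, hf⟩ : P (Nat.findGreatest P (Fintype.card V)) := Nat.findGreatest_spec hc h1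
  refine ⟨_, f, Nat.le_findGreatest hc h1, hf, fun g hg => ?_⟩
  have := Nat.le_findGreatest (P := P) hg.le_card ⟨g, hg⟩
  omega

lemma exists_ham_path {V : Type*} [Fintype V] (G : SimpleGraph V) (hG : G.Connected)
    (hn : 3 ≤ Fintype.card V)
    (hdeg : ∀ v a b c, G.Adj v a → G.Adj v b → G.Adj v c → a ≠ b → b ≠ c → a ≠ c → False) :
    ∃ f, IsPathFun G (Fintype.card V) f ∧ (∀ v, ∃ i, i < Fintype.card V ∧ f i = v) ∧
      ∀ i j, i < j → j < Fintype.card V → G.Adj (f i) (f j) →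
        j = i + 1 ∨ (i = 0 ∧ j + 1 = Fintype.card V) := by
  classical
  have := hG.nonempty
  obtain ⟨k, f, hk, hf, hmax⟩ := exists_max_path G
  have hlast : ∀ w, G.Adj (f (k - 1)) w → ∃ i, i < k ∧ f i = w := by
    intro w hw
    by_contra hcon
    push Not at hcon
    refine hmax (fun i => if i < k then f i else w) ⟨fun i hi => ?_, fun i j hi hj e => ?_⟩
    · have hik : i < k := by omega
      by_cases h' : i + 1 < k
      · simpa [hik, h'] using hf.1 i h'
      · have : i = k - 1 := by omega
        subst this
        simpa [hik, h'] using hw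
    · dsimp only at e
      split_ifs at e with h1 h2 h2
      · exact hf.2 i j h1 h2 e
      · exact absurd e (hcon i h1)
      · exact absurd e.symm (hcon j h2)
      · omega
  have hfirst : ∀ w, G.Adj (f 0) w → ∃ i, i < k ∧ f i = w := by
    intro w hw
    by_contra hcon
    push Not at hcon
    refine hmax (fun i => if i = 0 then w else f (i - 1)) ⟨fun i hi => ?_, fun i j hi hj e => ?_⟩
    · rcases i with _ | i
      · simpa using hw.symm
      · simpa using hf.1 i (by omega)
    · rcases i with _ | i <;> rcases j with _ | j
      · rfl
      · simp at e
        exact absurd e.symm (hcon j (by omega))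
      · simp at e
        exact absurd e (hcon i (by omega))
      · simp at e
        rw [hf.2 i j (by omega) (by omega) e]
  have hmid : ∀ i w, 0 < i → i + 1 < k → G.Adj (f i) w → w = f (i - 1) ∨ w = f (i + 1) := by
    intro i w h0 h1 hw
    by_contra hcon
    push Not at hcon
    have ha := hf.1 (i - 1) (by omega)
    rw [Nat.sub_add_cancel h0] at ha
    refine hdeg (f i) (f (i - 1)) (f (i + 1)) w ha.symm (hf.1 i h1) hw ?_ hcon.2.symm hcon.1.symm
    intro e
    have := hf.2 _ _ (by omega) h1 e
    omega
  have hclosed : ∀ i w, i < k → G.Adj (f i) w → ∃ j, j < k ∧ f j = w := by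
    intro i w hi hw
    rcases Nat.eq_zero_or_pos i with rfl | h0
    · exact hfirst w hw
    by_cases h1 : i + 1 < k
    · rcases hmid i w h0 h1 hw with h | h
      · exact ⟨i - 1, by omega, h.symm⟩
      · exact ⟨i + 1, h1, h.symm⟩
    · have : i = k - 1 := by omega
      subst this
      exact hlast w hw
  have hwalk : ∀ (u v : V) (p : G.Walk u v), (∃ i, i < k ∧ f i = u) → ∃ i, i < k ∧ f i = v := by
    intro u v p
    induction p with
    | nil => exact id
    | cons a p ih =>
      rintro ⟨i, hi, rfl⟩
      exact ih (hclosed i _ hi a)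
  have hall : ∀ v, ∃ i, i < k ∧ f i = v := by
    intro v
    obtain ⟨p⟩ := hG.preconnected (f 0) v
    exact hwalk _ _ p ⟨0, hk, rfl⟩
  have hkn : k = Fintype.card V := by
    apply le_antisymm hf.le_card
    have : Function.Surjective (fun i : Fin k => f i) := fun v => by
      obtain ⟨i, hi, e⟩ := hall v
      exact ⟨⟨i, hi⟩, e⟩
    simpa using Fintype.card_le_of_surjective _ this
  subst hkn
  refine ⟨f, hf, hall, fun i j hij hj ha => ?_⟩
  by_cases h1 : j + 1 < Fintype.card V
  · rcases hmid j (f i) (by omega) h1 ha.symm with h | h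
    · have := hf.2 _ _ (by omega) (by omega) h
      omega
    · have := hf.2 _ _ (by omega) (by omega) h
      omega
  · rcases Nat.eq_zero_or_pos i with rfl | h0
    · right; omega
    · rcases hmid i (f j) h0 (by omega) ha with h | h
      · have := hf.2 _ _ (by omega) (by omega) h
        omega
      · have := hf.2 _ _ (by omega) (by omega) h
        omega

lemma cycle_adj_iff {n : ℕ} (hn : 3 ≤ n) (a b : Fin n) : (SimpleGraph.cycleGraph n).Adj a b ↔
    (a.val + 1 = b.val ∨ b.val + 1 = a.val ∨ (a.val = 0 ∧ b.val + 1 = n) ∨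
      (b.val = 0 ∧ a.val + 1 = n)) := by
  rw [SimpleGraph.cycleGraph_adj']
  have ha := a.2
  have hb := b.2
  rw [Fin.sub_def, Fin.sub_def]
  dsimp only
  have m1 : (n - b.val + a.val) % n = if b.val ≤ a.val then a.val - b.val else n - b.val + a.val := by
    split_ifs with h
    · rw [show n - b.val + a.val = (a.val - b.val) + n by omega, Nat.add_mod_right]
      exact Nat.mod_eq_of_lt (by omega)
    · exact Nat.mod_eq_of_lt (by omega)
  have m2 : (n - a.val + b.val) % n = if a.val ≤ b.val then b.val - a.val else n - a.val + b.val := by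
    split_ifs with h
    · rw [show n - a.val + b.val = (b.val - a.val) + n by omega, Nat.add_mod_right]
      exact Nat.mod_eq_of_lt (by omega)
    · exact Nat.mod_eq_of_lt (by omega)
  rw [m1, m2]
  split_ifs <;> omega

lemma classify {V : Type*} [Fintype V] (G : SimpleGraph V) (hG : G.Connected)
    (hn : 3 ≤ Fintype.card V)
    (hdeg : ∀ v a b c, G.Adj v a → G.Adj v b → G.Adj v c → a ≠ b → b ≠ c → a ≠ c → False) :
    Nonempty (G ≃g SimpleGraph.pathGraph (Fintype.card V)) ∨
      Nonempty (G ≃g SimpleGraph.cycleGraph (Fintype.card V)) := by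
  obtain ⟨f, hf, hall, hadj⟩ := exists_ham_path G hG hn hdeg
  let E : Fin (Fintype.card V) ≃ V := Equiv.ofBijective (fun i => f i)
    ⟨fun i j e => Fin.ext (hf.2 i j i.2 j.2 e), fun v => by
      obtain ⟨i, hi, e⟩ := hall v
      exact ⟨⟨i, hi⟩, e⟩⟩
  have hE : ∀ i, E i = f i := fun i => rfl
  have trich : ∀ a b : Fin (Fintype.card V), G.Adj (f a) (f b) →
      a.val + 1 = b.val ∨ b.val + 1 = a.val ∨ (a.val = 0 ∧ b.val + 1 = Fintype.card V) ∨
      (b.val = 0 ∧ a.val + 1 = Fintype.card V) := by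
    intro a b h
    rcases lt_trichotomy a.val b.val with hlt | he | hlt
    · have := hadj _ _ hlt b.2 h
      omega
    · rw [he] at h
      exact absurd h (G.loopless.irrefl _)
    · have := hadj _ _ hlt a.2 h.symm
      omega
  have step : ∀ a b : Fin (Fintype.card V), a.val + 1 = b.val → G.Adj (f a) (f b) := by
    intro a b h
    rw [← h]
    exact hf.1 _ (by omega)
  by_cases hc : G.Adj (f 0) (f (Fintype.card V - 1))
  · right
    refine ⟨(RelIso.symm ⟨E, fun {a b} => ?_⟩)⟩
    rw [cycle_adj_iff hn, hE, hE]
    refine ⟨trich a b, ?_⟩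
    rintro (h | h | ⟨h, h'⟩ | ⟨h, h'⟩)
    · exact step a b h
    · exact (step b a h).symm
    · rw [h, show b.val = Fintype.card V - 1 by omega]
      exact hc
    · rw [h, show a.val = Fintype.card V - 1 by omega]
      exact hc.symm
  · left
    refine ⟨(RelIso.symm ⟨E, fun {a b} => ?_⟩)⟩
    rw [SimpleGraph.pathGraph_adj, hE, hE]
    constructor
    · intro h
      rcases trich a b h with h1 | h1 | ⟨h1, h2⟩ | ⟨h1, h2⟩
      · exact Or.inl h1
      · exact Or.inr h1
      · rw [h1, show b.val = Fintype.card V - 1 by omega] at h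
        exact absurd h hc
      · rw [h1, show a.val = Fintype.card V - 1 by omega] at h
        exact absurd h.symm hc
    · rintro (h | h)
      · exact step a b h
      · exact (step b a h).symm

lemma odd_of_cycle {V : Type*} (G : SimpleGraph V) (hG : G.Connected) (n : ℕ)
    (hn : 3 ≤ n) (h : EqUniq G) (e : G ≃g SimpleGraph.cycleGraph n) : Odd n := by
  by_contra hodd
  rw [Nat.not_odd_iff_even] at hodd
  obtain ⟨m, hm⟩ := hodd
  let r : Fin n → Fin n := fun i => if h0 : i.val = 0 then i else ⟨n - i.val, by omega⟩
  have hr : ∀ i, (r i).val = if i.val = 0 then 0 else n - i.val := by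
    intro i
    by_cases h0 : i.val = 0 <;> simp [r, h0]
  have hrr : ∀ i, r (r i) = i := by
    intro i
    apply Fin.ext
    have := i.2
    rw [hr, hr]
    split_ifs <;> omega
  have hradj : ∀ i j, (SimpleGraph.cycleGraph n).Adj i j →
      (SimpleGraph.cycleGraph n).Adj (r i) (r j) := by
    intro i j
    rw [cycle_adj_iff hn, cycle_adj_iff hn, hr, hr]
    have := i.2
    have := j.2
    split_ifs <;> omega
  let s : V → V := fun v => e.symm (r (e v))
  have hs : ∀ v, s (s v) = v := fun v => by simp [s, hrr]
  have hsadj : ∀ u v, G.Adj u v → G.Adj (s u) (s v) := fun u v huv =>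
    e.symm.map_rel_iff.2 (hradj _ _ (e.map_rel_iff.2 huv))
  have hd := dist_invol G hG s hs hsadj
  let x0 : Fin n := ⟨0, by omega⟩
  let x1 : Fin n := ⟨1, by omega⟩
  let xm : Fin n := ⟨m, by omega⟩
  let xl : Fin n := ⟨n - 1, by omega⟩
  have s0 : s (e.symm x0) = e.symm x0 := by
    have : r x0 = x0 := by apply Fin.ext; rw [hr]; simp [x0]
    simp [s, this]
  have sm : s (e.symm xm) = e.symm xm := by
    have : r xm = xm := by
      apply Fin.ext; rw [hr]; simp only [xm]
      split_ifs <;> omega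
    simp [s, this]
  have s1 : s (e.symm x1) = e.symm xl := by
    have : r x1 = xl := by apply Fin.ext; rw [hr]; simp [x1, xl]
    simp [s, this]
  have hne : e.symm x1 ≠ e.symm xl := by
    intro h
    have := congrArg Fin.val (e.symm.injective h)
    simp only [x1, xl] at this
    omega
  have d0 := hd (e.symm x0) (e.symm x1)
  have dm := hd (e.symm xm) (e.symm x1)
  rw [s0, s1] at d0
  rw [sm, s1] at dm
  have := h _ _ _ _ hne d0.symm dm.symm
  have := congrArg Fin.val (e.symm.injective this)
  simp only [x0, xm] at this
  omega

lemma frakd_of_iso {V : Type*} [Fintype V] (G : SimpleGraph V) (n : ℕ) (hn : 3 ≤ n)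
    (h : EqUniq G) (H : SimpleGraph (Fin n)) (hH : SimpleGraph.pathGraph n ≤ H) (e : G ≃g H) :
    frakd G = Fintype.card V - 1 := by
  let x0 : Fin n := ⟨0, by omega⟩
  let x1 : Fin n := ⟨1, by omega⟩
  let x2 : Fin n := ⟨2, by omega⟩
  refine frakd_of_eqUniq G h (e.symm x0) (e.symm x2) (e.symm x1) ?_ ?_
  · intro h
    have := congrArg Fin.val (e.symm.injective h)
    simp [x0, x2] at this
  · rw [SimpleGraph.dist_eq_one_iff_adj.2, SimpleGraph.dist_eq_one_iff_adj.2]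
    · exact e.symm.map_rel_iff.2 (hH (SimpleGraph.pathGraph_adj.2 (by simp [x1, x2])))
    · exact e.symm.map_rel_iff.2 (hH (SimpleGraph.pathGraph_adj.2 (by simp [x1, x0])))

theorem stmt_7 {V : Type*} [Fintype V] [DecidableEq V] (G : SimpleGraph V)
    (hG : G.Connected) (hn : 3 ≤ Fintype.card V) :
    frakd G = Fintype.card V - 1 ↔
      Nonempty (G ≃g SimpleGraph.pathGraph (Fintype.card V)) ∨
      (Odd (Fintype.card V) ∧ Nonempty (G ≃g SimpleGraph.cycleGraph (Fintype.card V))) := by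
  constructor
  · intro h
    have hE := eqUniq_of_frakd G hn h
    rcases classify G hG hn (deg_le_two G hG hE) with hp | ⟨⟨e⟩⟩
    · exact Or.inl hp
    · exact Or.inr ⟨odd_of_cycle G hG _ hn hE e, ⟨e⟩⟩
  · rintro (⟨⟨e⟩⟩ | ⟨hodd, ⟨e⟩⟩)
    · refine frakd_of_iso G _ hn ?_ _ le_rfl e
      refine eqUniq_of_label G hG (fun v => ((e v).val : ℤ)) ?_ ?_ ?_
      · intro u v h
        exact e.injective (Fin.ext (by simpa using h))
      · intro a b h
        omega
      · intro u v h
        have := SimpleGraph.pathGraph_adj.1 (e.map_rel_iff.2 h)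
        omega
    · refine frakd_of_iso G _ hn ?_ _ SimpleGraph.pathGraph_le_cycleGraph e
      refine eqUniq_of_label G hG (fun v => ((e v).val : ZMod (Fintype.card V))) ?_ ?_ ?_
      · intro u v h
        have := (ZMod.natCast_eq_natCast_iff' _ _ _).1 h
        rw [Nat.mod_eq_of_lt (e u).2, Nat.mod_eq_of_lt (e v).2] at this
        exact e.injective (Fin.ext this)
      · intro a b h
        have hu : IsUnit ((2 : ℕ) : ZMod (Fintype.card V)) :=
          (ZMod.isUnit_iff_coprime 2 _).2 (Nat.coprime_two_left.2 hodd)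
        exact hu.mul_left_cancel (by simpa using h)
      · intro u v h
        have hz : ((Fintype.card V : ℕ) : ZMod (Fintype.card V)) = 0 := ZMod.natCast_self _
        have := (cycle_adj_iff hn _ _).1 (e.map_rel_iff.2 h)
        rcases this with h | h | ⟨h, h'⟩ | ⟨h, h'⟩
        · left; rw [← h]; push_cast; ring
        · right; rw [← h]; push_cast; ring
        · right
          have h2 : (((e v).val + 1 : ℕ) : ZMod (Fintype.card V)) = 0 := by rw [h', hz]
          push_cast at h2
          rw [h]; push_cast
          linear_combination h2
        · left
          have h2 : (((e u).val + 1 : ℕ) : ZMod (Fintype.card V)) = 0 := by rw [h', hz]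
          push_cast at h2
          rw [h]; push_cast
          linear_combination -h2
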